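/- Let p : E → B be a continuous map, L a lifting function for p, U ⊆ E²_B, and s : U → C(I,E) a parametrised motion planning algorithm on U. For every triple (γ, e, e') with γ ∈ C(I,B), (e,e') ∈ U and p(e) = p(e') = γ(0), define s̃(γ,e,e')(t) = L(s(e,e')(t), γ)(t). Then: (i) t ↦ s̃(γ,e,e')(t) is a continuous path in E; (ii) p(s̃(γ,e,e')(t)) = γ(t) for all t ∈ I; (iii) s̃(γ,e,e')(0) = e; (iv) s̃(γ,e,e')(1) = L(e',γ)(1); and (v) the map (γ,e,e') ↦ s̃(γ,e,e') is continuous from Q⁻¹(U) = {(γ,e,e') ∈ C(I,B) × E × E : (e,e') ∈ U, γ(0) = p(e)} (with the subspace topology) to C(I,E). Thus s̃ is a motion planning algorithm working under variable external conditions whose variation γ is known in advance. -/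

import Mathlib

open unitInterval

/-- Following a fibrewise motion while lifting a base path is jointly continuous in the parameters
and in time. In particular, each motion `t ↦ L (s (e, e') t, γ) t` is a continuous path. -/
theorem continuous_lift_along_motion {E B : Type*} [TopologicalSpace E] [TopologicalSpace B]
    {p : E → B} {L : E × C(I, B) → C(I, E)} (hL : ContinuousOn L {q | p q.1 = q.2 0})
    {U : Set (E × E)} {s : E × E → C(I, E)} (hs : ContinuousOn s U)
    (hsp : ∀ q ∈ U, ∀ t : I, p (s q t) = p q.1) :
    Continuous fun x : {z : C(I, B) × E × E | (z.2.1, z.2.2) ∈ U ∧ z.1 0 = p z.2.1} × I =>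
      L (s (x.1.1.2.1, x.1.1.2.2) x.2, x.1.1.1) x.2 := by
  have hmotion : Continuous
      fun x : {z : C(I, B) × E × E | (z.2.1, z.2.2) ∈ U ∧ z.1 0 = p z.2.1} × I =>
        s (x.1.1.2.1, x.1.1.2.2) :=
    hs.comp_continuous (by fun_prop) fun x => x.1.2.1
  have hlift : Continuous
      fun x : {z : C(I, B) × E × E | (z.2.1, z.2.2) ∈ U ∧ z.1 0 = p z.2.1} × I =>
        L (s (x.1.1.2.1, x.1.1.2.2) x.2, x.1.1.1) :=
    hL.comp_continuous ((hmotion.eval continuous_snd).prodMk (by fun_prop))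
      fun x => (hsp _ x.1.2.1 x.2).trans x.1.2.2.symm
  exact hlift.eval continuous_snd

/-- Let `p : E → B` be continuous, `L` a lifting function for `p`
(a continuous map on `{(e,γ) : p e = γ 0}` with `L(e,γ)(0) = e` and
`p ∘ L(e,γ) = γ`), `U ⊆ E²_B` and `s` a parametrised motion planning algorithm
on `U`.  Define the extended algorithm `s̃(γ,e,e')(t) = L(s(e,e')(t), γ)(t)` on
`Q⁻¹(U) = {(γ,e,e') : (e,e') ∈ U, γ 0 = p e}`.  Then `s̃(γ,e,e')` is a
continuous path in `E` covering `γ`, starting at `e`, ending at `L(e',γ)(1)`,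
and `s̃` is continuous on `Q⁻¹(U)`. -/
theorem stmt_12 {E B : Type*} [TopologicalSpace E] [TopologicalSpace B]
    (p : E → B) (hp : Continuous p)
    -- the lifting function L
    (L : E × C(I, B) → C(I, E))
    (hLcont : ContinuousOn L {q | p q.1 = q.2 0})
    (hL0 : ∀ q : E × C(I, B), p q.1 = q.2 0 → L q 0 = q.1)
    (hLp : ∀ q : E × C(I, B), p q.1 = q.2 0 → ∀ t : I, p (L q t) = q.2 t)
    -- the parametrised motion planning algorithm s on U ⊆ E²_B
    (U : Set (E × E)) (hU : U ⊆ {q : E × E | p q.1 = p q.2})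
    (s : E × E → C(I, E)) (hscont : ContinuousOn s U)
    (hs0 : ∀ q ∈ U, s q 0 = q.1)
    (hs1 : ∀ q ∈ U, s q 1 = q.2)
    (hsp : ∀ q ∈ U, ∀ t : I, p (s q t) = p q.1)
    -- the set Q⁻¹(U)
    (Z : Set (C(I, B) × E × E))
    (hZ : Z = {z | (z.2.1, z.2.2) ∈ U ∧ z.1 0 = p z.2.1})
    -- the extended algorithm s̃
    (stilde : C(I, B) × E × E → C(I, E))
    (hdef : ∀ z ∈ Z, ∀ t : I, stilde z t = L (s (z.2.1, z.2.2) t, z.1) t) :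
    -- (ii) the (automatically continuous) path s̃(γ,e,e') covers γ
    (∀ z ∈ Z, ∀ t : I, p (stilde z t) = z.1 t) ∧
    -- (iii) it starts at e
    (∀ z ∈ Z, stilde z 0 = z.2.1) ∧
    -- (iv) it ends at L(e',γ)(1)
    (∀ z ∈ Z, stilde z 1 = L (z.2.2, z.1) 1) ∧
    -- (v) s̃ is continuous on Q⁻¹(U)
    ContinuousOn stilde Z := by
  subst hZ
  have hdom : ∀ z : C(I, B) × E × E, (z.2.1, z.2.2) ∈ U ∧ z.1 0 = p z.2.1 →
      ∀ t : I, p (s (z.2.1, z.2.2) t) = z.1 0 :=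
    fun z hz t => (hsp _ hz.1 t).trans hz.2.symm
  refine ⟨fun z hz t => ?_, fun z hz => ?_, fun z hz => ?_, ?_⟩
  · rw [hdef z hz]
    exact hLp _ (hdom z hz t) t
  · rw [hdef z hz, hL0 _ (hdom z hz 0)]
    exact hs0 _ hz.1
  · rw [hdef z hz, hs1 _ hz.1]
  · rw [continuousOn_iff_continuous_domRestrict]
    apply ContinuousMap.continuous_of_continuous_uncurry
    exact (continuous_lift_along_motion hLcont hscont hsp).congr
      fun x => (hdef x.1.1 x.1.2 x.2).symm
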